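/- Let m, h be positive integers, let Γ′ = Γ₀(mh∣h)+E be a group of Möbius transformations of ℍ, and let λ : Γ′ → ℂ^× be a group homomorphism satisfying λ(τ ↦ τ + 1/h) = e^{−2πi/h}. Let Γ = ker λ. Then for every τ ∈ ℍ there is exactly one point τ′ in the Γ-orbit of τ such that: (1) Im τ′ ≥ Im Kτ′ for all K ∈ Γ; (2) −1/2 < Re τ′ ≤ 1/2; and (3) Re τ′ ≥ Re Kτ′ for every K ∈ Γ such that Kτ′ also satisfies conditions (1) and (2). -/

import Mathlib

open UpperHalfPlane

/-- `f : ℍ → ℍ` is the Möbius transformation induced by the integer matrix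
`[[A, B],[C, D]]`. -/
def IsMoebiusOf (A B C D : ℤ) (f : UpperHalfPlane → UpperHalfPlane) : Prop :=
  ∀ τ : UpperHalfPlane,
    (f τ : ℂ) = ((A : ℂ) * (τ : ℂ) + (B : ℂ)) / ((C : ℂ) * (τ : ℂ) + (D : ℂ))

/-- The set `Γ₀(mh∣h)+E` of Möbius transformations of `ℍ` induced by integer
matrices `[[khw, x],[mh²y, khz]]` with `k ∈ E` and `kwz − (m/k)xy = 1`. -/
def GammaSet (m h : ℕ) (E : Set ℕ) : Set (UpperHalfPlane → UpperHalfPlane) :=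
  { f | ∃ (k : ℕ) (w x y z : ℤ), k ∈ E ∧
      (k : ℤ) * w * z - ((m / k : ℕ) : ℤ) * x * y = 1 ∧
      IsMoebiusOf ((k : ℤ) * (h : ℤ) * w) x ((m : ℤ) * (h : ℤ) ^ 2 * y)
        ((k : ℤ) * (h : ℤ) * z) f }

/-- A set of self-maps of `ℍ` is a group under composition. -/
def IsGroupUnderComp (Γ : Set (UpperHalfPlane → UpperHalfPlane)) : Prop :=
  id ∈ Γ ∧ (∀ f ∈ Γ, ∀ g ∈ Γ, f ∘ g ∈ Γ) ∧
    ∀ f ∈ Γ, ∃ g ∈ Γ, f ∘ g = id ∧ g ∘ f = id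

/-- The fundamental-domain conditions for `Γ` with width `1/h` at a point `τ`:
(1) `Im τ ≥ Im Kτ` for all `K ∈ Γ`; (2) `−1/(2h) < Re τ ≤ 1/(2h)`; (3)
`Re τ ≥ Re Kτ` for every `K ∈ Γ` such that `Kτ` also satisfies (1) and (2). -/
def FDConds (Γ : Set (UpperHalfPlane → UpperHalfPlane)) (h : ℕ)
    (τ : UpperHalfPlane) : Prop :=
  (∀ K ∈ Γ, (K τ).im ≤ τ.im) ∧
    (-(1 / (2 * (h : ℝ))) < τ.re ∧ τ.re ≤ 1 / (2 * (h : ℝ))) ∧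
    ∀ K ∈ Γ,
      ((∀ K' ∈ Γ, (K' (K τ)).im ≤ (K τ).im) ∧
        -(1 / (2 * (h : ℝ))) < (K τ).re ∧ (K τ).re ≤ 1 / (2 * (h : ℝ))) →
      (K τ).re ≤ τ.re

lemma fd_denom_ne {A B C D : ℤ} {f : UpperHalfPlane → UpperHalfPlane}
    (hf : IsMoebiusOf A B C D f) (τ : UpperHalfPlane) :
    (C : ℂ) * (τ : ℂ) + (D : ℂ) ≠ 0 := by
  intro h0
  have h1 := hf τ
  rw [h0, div_zero] at h1
  have h2 := (f τ).im_pos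
  have h3 : (f τ).im = 0 := by
    rw [← UpperHalfPlane.coe_im, h1]; rfl
  linarith

lemma fd_mul {A B C D : ℤ} {f : UpperHalfPlane → UpperHalfPlane}
    (hf : IsMoebiusOf A B C D f) (τ : UpperHalfPlane) :
    (f τ : ℂ) * ((C : ℂ) * (τ : ℂ) + (D : ℂ)) = (A : ℂ) * (τ : ℂ) + (B : ℂ) := by
  rw [hf τ, div_mul_cancel₀ _ (fd_denom_ne hf τ)]

lemma fd_im {A B C D : ℤ} {f : UpperHalfPlane → UpperHalfPlane}
    (hf : IsMoebiusOf A B C D f) (τ : UpperHalfPlane) :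
    (f τ).im * Complex.normSq ((C : ℂ) * (τ : ℂ) + (D : ℂ)) =
      ((A * D - B * C : ℤ) : ℝ) * τ.im := by
  have h := fd_mul hf τ
  have h1 := congrArg Complex.re h
  have h2 := congrArg Complex.im h
  simp [Complex.normSq_apply] at h1 h2 ⊢
  linear_combination (C * τ.re + D : ℝ) * h2 - (C * τ.im : ℝ) * h1

lemma fd_finite_pairs (τ : UpperHalfPlane) (R : ℝ) :
    {p : ℤ × ℤ | Complex.normSq ((p.1 : ℂ) * (τ : ℂ) + (p.2 : ℂ)) ≤ R}.Finite := by
  have hi := τ.im_pos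
  set a : ℝ := Real.sqrt R / τ.im with ha
  set b : ℝ := Real.sqrt R + a * |τ.re| with hb
  apply Set.Finite.subset ((Set.finite_Icc (-⌈a⌉) ⌈a⌉).prod (Set.finite_Icc (-⌈b⌉) ⌈b⌉))
  rintro ⟨C, D⟩ h
  simp [Complex.normSq_apply] at h
  have h1 : |(C : ℝ) * τ.im| ≤ Real.sqrt R :=
    Real.abs_le_sqrt (by nlinarith [mul_self_nonneg ((C : ℝ) * τ.re + D)])
  have h2 : |(C : ℝ) * τ.re + D| ≤ Real.sqrt R :=
    Real.abs_le_sqrt (by nlinarith [mul_self_nonneg ((C : ℝ) * τ.im)])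
  have h3 : |(C : ℝ)| ≤ a := by
    rw [ha, le_div_iff₀ hi]; rwa [abs_mul, abs_of_pos hi] at h1
  have h4 : |(D : ℝ)| ≤ b := by
    have : (D : ℝ) = (C * τ.re + D) - C * τ.re := by ring
    rw [this]
    refine (abs_sub _ _).trans ?_
    rw [abs_mul, hb]
    gcongr
  have key : ∀ (n : ℤ) (r : ℝ), |(n : ℝ)| ≤ r → -⌈r⌉ ≤ n ∧ n ≤ ⌈r⌉ := by
    intro n r hr
    have := hr.trans (Int.le_ceil r)
    rw [abs_le] at this
    exact_mod_cast this
  exact ⟨key _ _ h3, key _ _ h4⟩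

/-- Translation by `n / h`. -/
noncomputable def fdT (h : ℕ) (n : ℤ) (τ : UpperHalfPlane) : UpperHalfPlane :=
  ((n : ℝ) / (h : ℝ)) +ᵥ τ

lemma fdT_coe (h : ℕ) (n : ℤ) (τ : UpperHalfPlane) :
    (fdT h n τ : ℂ) = (τ : ℂ) + (n : ℂ) / (h : ℂ) := by
  simp [fdT, add_comm]

lemma fdT_re (h : ℕ) (n : ℤ) (τ : UpperHalfPlane) :
    (fdT h n τ).re = τ.re + (n : ℝ) / (h : ℝ) := by
  simp [fdT, add_comm]

lemma fdT_im (h : ℕ) (n : ℤ) (τ : UpperHalfPlane) : (fdT h n τ).im = τ.im := by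
  simp [fdT]

lemma fdT_comp (h : ℕ) (a b : ℤ) : fdT h a ∘ fdT h b = fdT h (a + b) := by
  funext τ
  apply UpperHalfPlane.ext
  simp only [Function.comp, fdT_coe]
  push_cast; ring

lemma fdT_zero (h : ℕ) : fdT h 0 = id := by
  funext τ
  apply UpperHalfPlane.ext
  simp [fdT_coe]

lemma fd_one_mem (m h : ℕ) (hm : 0 < m) (hh : 0 < h) (E : Set ℕ)
    (hid : id ∈ GammaSet m h E) : 1 ∈ E := by
  obtain ⟨k, w, x, y, z, hk, hdet, hf⟩ := hid
  have e1 := fd_mul hf ⟨Complex.I, by simp⟩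
  have e2 := fd_mul hf ⟨2 * Complex.I, by simp⟩
  have e1r := congrArg Complex.re e1
  have e2r := congrArg Complex.re e2
  simp [pow_two] at e1r e2r
  have hc : ((m : ℝ) * ((h : ℝ) * (h : ℝ)) * (y : ℝ)) = 0 := by linarith
  have hm' : (m : ℝ) ≠ 0 := by positivity
  have hh' : (h : ℝ) * (h : ℝ) ≠ 0 := by positivity
  have hy : y = 0 := by
    have := (mul_eq_zero.1 hc).resolve_left (mul_ne_zero hm' hh')
    exact_mod_cast this
  subst hy
  have : (k : ℤ) ∣ 1 := ⟨w * z, by linarith⟩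
  have : k = 1 := by exact_mod_cast Int.eq_one_of_dvd_one (by positivity) this
  exact this ▸ hk

lemma fdT_mem (m h : ℕ) (hm : 0 < m) (hh : 0 < h) (E : Set ℕ)
    (hid : id ∈ GammaSet m h E) (n : ℤ) : fdT h n ∈ GammaSet m h E := by
  refine ⟨1, 1, n, 0, 1, fd_one_mem m h hm hh E hid, by simp, ?_⟩
  intro τ
  have : (h : ℂ) ≠ 0 := by exact_mod_cast hh.ne'
  rw [fdT_coe]
  simp
  field_simp

lemma fd_finite (m h : ℕ) (hm : 0 < m) (E : Set ℕ)
    (hE : ∀ k ∈ E, k ∣ m ∧ Nat.gcd k (m / k) = 1) (τ : UpperHalfPlane)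
    (ε M : ℝ) (hε : 0 < ε) :
    {σ : UpperHalfPlane | (∃ f ∈ GammaSet m h E, f τ = σ) ∧ |σ.re| ≤ 1 ∧ ε ≤ σ.im ∧
      σ.im ≤ M}.Finite := by
  set R : ℝ := (m * h ^ 2) * τ.im / ε with hR
  have F1 := fd_finite_pairs τ R
  have F2 := fd_finite_pairs τ ((1 + M ^ 2) * R)
  have F := ((F2.prod F1).image (fun p : (ℤ × ℤ) × (ℤ × ℤ) =>
    ((p.1.1 : ℂ) * (τ : ℂ) + p.1.2) / ((p.2.1 : ℂ) * (τ : ℂ) + p.2.2)))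
  refine Set.Finite.of_finite_image (f := fun σ : UpperHalfPlane => (σ : ℂ)) (F.subset ?_)
    (fun a _ b _ hab => UpperHalfPlane.ext hab)
  rintro _ ⟨σ, ⟨⟨f, ⟨k, w, x, y, z, hk, hdet, hf⟩, rfl⟩, hre, him, hM⟩, rfl⟩
  have hkm := (hE k hk).1
  have hmk : (k : ℤ) * ((m / k : ℕ) : ℤ) = m := by
    exact_mod_cast Nat.mul_div_cancel' hkm
  have hD : ((k : ℤ) * (h : ℤ) * w) * ((k : ℤ) * (h : ℤ) * z) -
      x * ((m : ℤ) * (h : ℤ) ^ 2 * y) = k * h ^ 2 := by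
    rw [← hmk]; linear_combination (k * h ^ 2 : ℤ) * hdet
  have h1 := fd_im hf τ
  have h2 := fd_mul hf τ
  rw [hD] at h1
  have h3 := hf τ
  generalize (k : ℤ) * (h : ℤ) * w = A at *
  generalize (m : ℤ) * (h : ℤ) ^ 2 * y = C at *
  generalize (k : ℤ) * (h : ℤ) * z = D at *
  have hkm' : (k : ℝ) ≤ m := by exact_mod_cast Nat.le_of_dvd hm hkm
  have hτ := τ.im_pos
  have hnn := Complex.normSq_nonneg ((C : ℂ) * (τ : ℂ) + (D : ℂ))
  have b1 : Complex.normSq ((C : ℂ) * (τ : ℂ) + (D : ℂ)) ≤ R := by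
    rw [hR, le_div_iff₀ hε]
    calc _ ≤ Complex.normSq ((C : ℂ) * (τ : ℂ) + (D : ℂ)) * (f τ).im := by gcongr
      _ = (k * h ^ 2) * τ.im := by rw [mul_comm, h1]; push_cast; ring
      _ ≤ _ := by gcongr
  have b2 : Complex.normSq ((A : ℂ) * (τ : ℂ) + (x : ℂ)) ≤ (1 + M ^ 2) * R := by
    rw [← h2, Complex.normSq_mul]
    have : Complex.normSq (f τ : ℂ) ≤ 1 + M ^ 2 := by
      rw [Complex.normSq_apply]
      simp only [UpperHalfPlane.coe_re, UpperHalfPlane.coe_im]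
      have := (f τ).im_pos
      rw [abs_le] at hre
      nlinarith
    gcongr
  exact ⟨((A, x), (C, D)), ⟨b2, b1⟩, h3.symm⟩

lemma fd_strip (r : ℝ) : ∃ n : ℤ, -(1 / 2) < r + n ∧ r + n ≤ 1 / 2 := by
  refine ⟨⌊1 / 2 - r⌋, ?_, ?_⟩
  · linarith [Int.lt_floor_add_one (1 / 2 - r)]
  · linarith [Int.floor_le (1 / 2 - r)]


/-- Fundamental domain for `Γ₀(mh‖h)+E = ker λ`: let `Γ′ = Γ₀(mh∣h)+E` be a
group of Möbius transformations of `ℍ`, and `λ : Γ′ → ℂ^×` a homomorphism with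
`λ(τ ↦ τ + 1/h) = e^{−2πi/h}`.  Assuming every `Γ′`-orbit meets the fundamental
domain of `Γ′` of width `1/h`, every orbit of `Γ = ker λ` contains exactly one
point satisfying the fundamental-domain conditions for `Γ` with width `1`. -/
theorem fundamental_domain_kernel_exists_unique (m h : ℕ) (hm : 0 < m)
    (hh : 0 < h) (E : Set ℕ) (hE : ∀ k ∈ E, k ∣ m ∧ Nat.gcd k (m / k) = 1)
    (hgrp : IsGroupUnderComp (GammaSet m h E))
    (lam : (UpperHalfPlane → UpperHalfPlane) → ℂ)
    (hlam_ne : ∀ f ∈ GammaSet m h E, lam f ≠ 0)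
    (hlam_mul : ∀ f ∈ GammaSet m h E, ∀ g ∈ GammaSet m h E,
      lam (f ∘ g) = lam f * lam g)
    (hlam_T : ∀ f ∈ GammaSet m h E,
      (∀ τ : UpperHalfPlane, (f τ : ℂ) = (τ : ℂ) + 1 / (h : ℂ)) →
      lam f = Complex.exp (-(2 * Real.pi * Complex.I) / (h : ℂ)))
    (hFD : ∀ τ : UpperHalfPlane, ∃ g ∈ GammaSet m h E,
      FDConds (GammaSet m h E) h (g τ))
    (τ : UpperHalfPlane) :
    ∃! τ' : UpperHalfPlane,
      (∃ f ∈ GammaSet m h E, lam f = 1 ∧ f τ = τ') ∧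
        FDConds {f | f ∈ GammaSet m h E ∧ lam f = 1} 1 τ' := by
  obtain ⟨hid, hcomp, hinv⟩ := hgrp
  have hT := fdT_mem m h hm hh E hid
  have hh0 : (h : ℝ) ≠ 0 := by positivity
  have hhC : (h : ℂ) ≠ 0 := by exact_mod_cast hh.ne'
  have lid : lam id = 1 := by
    have := hlam_mul id hid id hid
    simp only [Function.comp_id] at this
    exact (mul_eq_left₀ (hlam_ne id hid)).1 this.symm
  have lT : ∀ n : ℕ, lam (fdT h n) =
      Complex.exp (-(2 * Real.pi * Complex.I) / (h : ℂ)) ^ n := by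
    intro n
    induction n with
    | zero => simp [fdT_zero, lid]
    | succ n ih =>
      have h1 := hlam_T (fdT h 1) (hT 1) (fun τ => by simp [fdT_coe])
      have h2 := hlam_mul _ (hT n) _ (hT 1)
      rw [fdT_comp] at h2
      push_cast
      rw [h2, ih, h1, pow_succ]
  have lTn : ∀ n : ℕ, lam (fdT h ((h * n : ℕ) : ℤ)) = 1 := by
    intro n
    rw [lT, pow_mul, ← Complex.exp_nat_mul, mul_div_cancel₀ _ hhC, Complex.exp_neg,
      Complex.exp_two_pi_mul_I]
    simp
  have lTz : ∀ n : ℤ, lam (fdT h (h * n)) = 1 := by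
    intro n
    obtain ⟨a, rfl | rfl⟩ := n.eq_nat_or_neg
    · exact_mod_cast lTn a
    · have h2 := hlam_mul _ (hT ((h * a : ℕ) : ℤ)) _ (hT ((h : ℤ) * -(a : ℤ)))
      rw [fdT_comp, lTn] at h2
      have : ((h * a : ℕ) : ℤ) + (h : ℤ) * -(a : ℤ) = 0 := by push_cast; ring
      rw [this, fdT_zero, lid, one_mul] at h2
      exact h2.symm
  have strip : ∀ f ∈ GammaSet m h E, lam f = 1 → ∃ g ∈ GammaSet m h E, lam g = 1 ∧
      (g τ).im = (f τ).im ∧ -(1 / 2) < (g τ).re ∧ (g τ).re ≤ 1 / 2 := by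
    intro f hf hl
    obtain ⟨n, hn⟩ := fd_strip (f τ).re
    refine ⟨fdT h (h * n) ∘ f, hcomp _ (hT _) _ hf, ?_, ?_, ?_⟩
    · rw [hlam_mul _ (hT _) _ hf, lTz, hl, one_mul]
    · simp [fdT_im]
    · simp only [Function.comp, fdT_re]
      push_cast
      rwa [mul_div_cancel_left₀ _ hh0]
  obtain ⟨g0, hg0, hmax0, -⟩ := hFD τ
  have hbd : ∀ f ∈ GammaSet m h E, (f τ).im ≤ (g0 τ).im := by
    intro f hf
    obtain ⟨g', hg', -, h2⟩ := hinv g0 hg0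
    have := hmax0 (f ∘ g') (hcomp _ hf _ hg')
    have e : g' (g0 τ) = τ := congrFun h2 τ
    simpa [e] using this
  let S : Set UpperHalfPlane := {σ | (∃ f ∈ GammaSet m h E, lam f = 1 ∧ f τ = σ) ∧
    (-(1 / 2) < σ.re ∧ σ.re ≤ 1 / 2) ∧ τ.im ≤ σ.im}
  have hS : S.Finite := by
    refine (fd_finite m h hm E hE τ τ.im (g0 τ).im τ.im_pos).subset ?_
    rintro σ ⟨⟨f, hf, hl, rfl⟩, ⟨h1, h2⟩, h3⟩
    exact ⟨⟨f, hf, rfl⟩, by rw [abs_le]; constructor <;> linarith, h3, hbd f hf⟩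
  have hSne : S.Nonempty := by
    obtain ⟨g, hg, hl, h1, h2⟩ := strip id hid lid
    exact ⟨g τ, ⟨g, hg, hl, rfl⟩, h2, h1.ge⟩
  obtain ⟨σ, hσ, hmax⟩ := Set.exists_max_image S (fun s => toLex (s.im, s.re)) hS hSne
  simp only [Prod.Lex.toLex_le_toLex] at hmax
  obtain ⟨⟨f, hf, hl, rfl⟩, hre, him⟩ := hσ
  have hmem : ∀ K ∈ {f | f ∈ GammaSet m h E ∧ lam f = 1},
      (K ∘ f) ∈ GammaSet m h E ∧ lam (K ∘ f) = 1 := by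
    rintro K ⟨hK, hKl⟩
    exact ⟨hcomp _ hK _ hf, by rw [hlam_mul _ hK _ hf, hl, hKl, one_mul]⟩
  have c1 : ∀ g ∈ GammaSet m h E, lam g = 1 → (g τ).im ≤ (f τ).im := by
    intro g hg hgl
    obtain ⟨g', hg', hl', h1, h2⟩ := strip g hg hgl
    by_contra hlt
    push Not at hlt
    rcases hmax (g' τ) ⟨⟨g', hg', hl', rfl⟩, h2, by linarith⟩ with h3 | h3
    · linarith
    · linarith [h3.1]
  have hfd : FDConds {f | f ∈ GammaSet m h E ∧ lam f = 1} 1 (f τ) := by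
    refine ⟨fun K hK => c1 _ (hmem K hK).1 (hmem K hK).2, by simpa using hre, ?_⟩
    rintro K hK ⟨h1, h2⟩
    obtain ⟨g, hg, hgl⟩ : ∃ g ∈ {f | f ∈ GammaSet m h E ∧ lam f = 1}, g (K (f τ)) = f τ := by
      obtain ⟨g', hg', -, e⟩ := hinv K hK.1
      refine ⟨g', ⟨hg', ?_⟩, congrFun e _⟩
      have := hlam_mul _ hg' _ hK.1
      rw [e, lid, hK.2, mul_one] at this
      exact this.symm
    have h3 := h1 g hg
    rw [hgl] at h3
    have h4 := c1 _ (hmem K hK).1 (hmem K hK).2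
    simp only [Function.comp] at h4
    rcases hmax (K (f τ)) ⟨⟨K ∘ f, (hmem K hK).1, (hmem K hK).2, rfl⟩, by simpa using h2,
      him.trans h3⟩ with h5 | h5
    · linarith
    · exact h5.2
  refine ⟨f τ, ⟨⟨f, hf, hl, rfl⟩, hfd⟩, ?_⟩
  rintro _ ⟨⟨g, hg, hgl, rfl⟩, hgd⟩
  have trans : ∀ a ∈ GammaSet m h E, lam a = 1 → ∀ b ∈ GammaSet m h E, lam b = 1 →
      ∃ K ∈ {f | f ∈ GammaSet m h E ∧ lam f = 1}, K (a τ) = b τ := by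
    intro a ha hal b hb hbl
    obtain ⟨a', ha', -, e⟩ := hinv a ha
    have h1 := hlam_mul _ ha' _ ha
    rw [e, lid, hal, mul_one] at h1
    refine ⟨b ∘ a', ⟨hcomp _ hb _ ha', by rw [hlam_mul _ hb _ ha', hbl, ← h1, one_mul]⟩, ?_⟩
    exact congrArg b (congrFun e τ)
  obtain ⟨K, hK, eK⟩ := trans g hg hgl f hf hl
  obtain ⟨L, hL, eL⟩ := trans f hf hl g hg hgl
  have i1 := hgd.1 K hK
  have i2 := hfd.1 L hL
  have r1 := hgd.2.2 K hK
  have r2 := hfd.2.2 L hL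
  rw [eK] at i1 r1
  rw [eL] at i2 r2
  have r1' := r1 ⟨hfd.1, hfd.2.1⟩
  have r2' := r2 ⟨hgd.1, hgd.2.1⟩
  apply UpperHalfPlane.ext
  apply Complex.ext
  · exact le_antisymm r2' r1'
  · exact le_antisymm i2 i1
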